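/- arXiv:2507.01521 — 2 statements merged into one kernel-verified Lean document; each statement's English description precedes it below -/
import Mathlib

section
/- Let η(a,b,c,d) be the symmetric trapezoid function on the circle (0 outside [a,d], 1 on [b,c], linear on [a,b] and [c,d]) with b−a = d−c and d−c comparable to d (say d ≤ C(d−c)). Then the total variation of the sequence of its Fourier coefficients is bounded: Σ_{k∈Z} |η̂(k+1) − η̂(k)| ≤ C'·d. -/
open MeasureTheory intervalIntegral

/-- The trapezoid function `η(a,b,c,d)`: `0` outside `[a,d]`, `1` on `[b,c]`,
linear on `[a,b]` and `[c,d]`. -/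
noncomputable def trap (a b c d x : ℝ) : ℝ :=
  if x < a then 0 else if x < b then (x - a) / (b - a)
  else if x ≤ c then 1 else if x ≤ d then (d - x) / (d - c) else 0

/-- The `n`-th Fourier coefficient of the trapezoid, on the circle `[-π,π]`. -/
noncomputable def trapCoeff (a b c d : ℝ) (n : ℤ) : ℂ :=
  (2 * (Real.pi : ℂ))⁻¹ *
    ∫ x in (-Real.pi)..Real.pi, (trap a b c d x : ℂ) * Complex.exp (-Complex.I * n * x)

/-- triangle function -/
noncomputable def tri (t x : ℝ) : ℝ := max (t - |x|) 0

lemma tri_cont (t : ℝ) : Continuous (tri t) := by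
  unfold tri; fun_prop

lemma trap_eq (c d x : ℝ) (hc : 0 ≤ c) (hcd : c < d) :
    trap (-d) (-c) c d x = (tri d x - tri c x) / (d - c) := by
  have h : d - c ≠ 0 := by linarith
  have h' : -c - -d ≠ 0 := by intro h; linarith
  unfold trap tri
  split_ifs with h1 h2 h3 h4
  · rw [abs_of_neg (by linarith), max_eq_right (by linarith), max_eq_right (by linarith)]; simp
  · rw [abs_of_neg (by linarith), max_eq_left (by linarith), max_eq_right (by linarith)]
    rw [div_eq_div_iff h' h]; ring
  · have : |x| ≤ c := abs_le.2 ⟨by linarith, h3⟩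
    rw [max_eq_left (by linarith), max_eq_left (by linarith)]
    rw [eq_div_iff h]; ring
  · rw [abs_of_pos (by linarith), max_eq_left (by linarith), max_eq_right (by linarith)]
    simp
  · rw [abs_of_pos (by linarith), max_eq_right (by linarith), max_eq_right (by linarith)]; simp

lemma trap_cont (c d : ℝ) (hc : 0 ≤ c) (hcd : c < d) :
    Continuous (trap (-d) (-c) c d) := by
  have : trap (-d) (-c) c d = fun x => (tri d x - tri c x) / (d - c) := by
    ext x; exact trap_eq c d x hc hcd
  rw [this]
  have := tri_cont d
  have := tri_cont c
  fun_prop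

lemma trap_even (c d x : ℝ) (hc : 0 ≤ c) (hcd : c < d) :
    trap (-d) (-c) c d (-x) = trap (-d) (-c) c d x := by
  rw [trap_eq _ _ _ hc hcd, trap_eq _ _ _ hc hcd]; simp [tri]

lemma coeff_even (c d : ℝ) (hc : 0 ≤ c) (hcd : c < d) (n : ℤ) :
    trapCoeff (-d) (-c) c d (-n) = trapCoeff (-d) (-c) c d n := by
  unfold trapCoeff
  congr 1
  have := intervalIntegral.integral_comp_neg (a := -Real.pi) (b := Real.pi)
    (fun x : ℝ => (trap (-d) (-c) c d x : ℂ) * Complex.exp (-Complex.I * n * x))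
  rw [neg_neg] at this
  rw [← this]
  congr 1
  ext x
  rw [trap_even _ _ _ hc hcd]
  congr 2
  push_cast
  ring

lemma trap_abs (c d x : ℝ) (hc : 0 ≤ c) (hcd : c < d) :
    |trap (-d) (-c) c d x| ≤ Set.indicator (Set.Ioc (-d) d) (fun _ => (1:ℝ)) x := by
  have h : 0 < d - c := by linarith
  have e := trap_eq c d x hc hcd
  by_cases hx : x ∈ Set.Ioc (-d) d
  · rw [Set.indicator_of_mem hx, e, abs_div, abs_of_pos h, div_le_one h]
    unfold tri
    have := abs_max_sub_max_le_abs (d - |x|) (c - |x|) 0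
    rw [show d - |x| - (c - |x|) = d - c by ring, abs_of_pos h] at this
    exact this
  · rw [Set.indicator_of_notMem hx, e]
    have : d ≤ |x| := by
      by_contra hh
      push Not at hh
      exact hx ⟨(abs_lt.1 hh).1, (abs_lt.1 hh).2.le⟩
    unfold tri
    rw [max_eq_right (by linarith), max_eq_right (by linarith)]; simp

lemma low (c d : ℝ) (hc : 0 ≤ c) (hcd : c < d) (hd : d ≤ Real.pi) (n : ℤ) :
    ‖trapCoeff (-d) (-c) c d (n + 1) - trapCoeff (-d) (-c) c d n‖ ≤ d ^ 2 := by
  have hp := Real.pi_pos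
  have hct := trap_cont c d hc hcd
  unfold trapCoeff
  rw [← mul_sub, ← intervalIntegral.integral_sub]
  rotate_left
  · apply Continuous.intervalIntegrable; fun_prop
  · apply Continuous.intervalIntegrable; fun_prop
  have key : ‖∫ x in (-Real.pi)..Real.pi, ((trap (-d) (-c) c d x : ℂ) *
      Complex.exp (-Complex.I * (n + 1 : ℤ) * x) -
      (trap (-d) (-c) c d x : ℂ) * Complex.exp (-Complex.I * n * x))‖ ≤ 2 * d ^ 2 := by
    calc _ ≤ ∫ x in (-Real.pi)..Real.pi, Set.indicator (Set.Ioc (-d) d) (fun _ => d) x := by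
          apply intervalIntegral.norm_integral_le_of_norm_le (by linarith)
          · filter_upwards with x _
            have e : ((trap (-d) (-c) c d x : ℂ) * Complex.exp (-Complex.I * (n + 1 : ℤ) * x) -
              (trap (-d) (-c) c d x : ℂ) * Complex.exp (-Complex.I * n * x))
              = (trap (-d) (-c) c d x : ℂ) * (Complex.exp (Complex.I * (-(n * x) : ℝ)) *
                (Complex.exp (Complex.I * (-x : ℝ)) - 1)) := by
              rw [mul_sub, ← Complex.exp_add, mul_sub]
              congr 2
              · push_cast; ring_nf
              · push_cast; ring_nf
            rw [e, norm_mul, norm_mul, Complex.norm_exp_I_mul_ofReal, one_mul,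
              Complex.norm_real, Real.norm_eq_abs]
            have h1 := trap_abs c d x hc hcd
            have h2 := Real.norm_exp_I_mul_ofReal_sub_one_le (x := -x)
            by_cases hx : x ∈ Set.Ioc (-d) d
            · rw [Set.indicator_of_mem hx] at h1 ⊢
              rw [norm_neg, Real.norm_eq_abs] at h2
              have : |x| ≤ d := abs_le.2 ⟨hx.1.le, hx.2⟩
              calc _ ≤ 1 * d := by gcongr; exact h2.trans this
                _ = d := one_mul d
            · rw [Set.indicator_of_notMem hx] at h1 ⊢
              rw [le_antisymm h1 (abs_nonneg _)]; simp
          · rw [intervalIntegrable_iff]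
            apply IntegrableOn.indicator _ measurableSet_Ioc
            simp
      _ = 2 * d ^ 2 := by
          rw [intervalIntegral.integral_of_le (by linarith),
            setIntegral_indicator measurableSet_Ioc,
            Set.inter_eq_right.2 (Set.Ioc_subset_Ioc (by linarith) hd)]
          simp [Measure.real]
          rw [ENNReal.toReal_ofReal (by linarith)]; ring
  rw [norm_mul]
  have : ‖(2 * (Real.pi : ℂ))⁻¹‖ ≤ 1 / 2 := by
    rw [norm_inv, norm_mul, Complex.norm_real, Real.norm_eq_abs, abs_of_pos hp]
    simp only [Complex.norm_ofNat]
    rw [inv_eq_one_div]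
    apply one_div_le_one_div_of_le (by norm_num)
    nlinarith [Real.pi_gt_three]
  calc _ ≤ 1 / 2 * (2 * d ^ 2) := by gcongr
    _ = d ^ 2 := by ring

lemma piece (t e u v : ℝ) (n : ℂ) (hn : n ≠ 0) :
    ∫ x in u..v, ((t + e * x : ℝ) : ℂ) * Complex.exp (-Complex.I * n * x) =
      ((t + e * v) * Complex.I / n + e / n ^ 2) * Complex.exp (-Complex.I * n * v)
      - ((t + e * u) * Complex.I / n + e / n ^ 2) * Complex.exp (-Complex.I * n * u) := by
  have := intervalIntegral.integral_eq_sub_of_hasDerivAt (a := u) (b := v)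
    (f := fun x : ℝ => ((t + e * x) * Complex.I / n + e / n ^ 2) * Complex.exp (-Complex.I * n * x))
    (f' := fun x : ℝ => ((t + e * x : ℝ) : ℂ) * Complex.exp (-Complex.I * n * x)) ?_ ?_
  · exact this
  · intro x _
    have h0 : HasDerivAt (fun x : ℝ => (x : ℂ)) 1 x := Complex.ofRealCLM.hasDerivAt
    have h1 := (((((h0.const_mul (e:ℂ)).const_add (t:ℂ)).mul_const Complex.I).div_const n).add_const
      ((e:ℂ) / n ^ 2)).mul ((h0.const_mul (-Complex.I * n)).cexp)
    refine HasDerivAt.congr_deriv h1 ?_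
    push_cast
    field_simp
    ring_nf
    simp only [Complex.I_sq]
    ring
  · apply Continuous.intervalIntegrable; fun_prop

lemma tri_int (t : ℝ) (ht : 0 ≤ t) (htp : t ≤ Real.pi) (n : ℤ) (hn : n ≠ 0) :
    ∫ x in (-Real.pi)..Real.pi, (tri t x : ℂ) * Complex.exp (-Complex.I * n * x) =
      ((2 * (1 - Real.cos (n * t)) / n ^ 2 : ℝ) : ℂ) := by
  have hct := tri_cont t
  have hi : ∀ a b : ℝ, IntervalIntegrable
      (fun x : ℝ => (tri t x : ℂ) * Complex.exp (-Complex.I * n * x)) volume a b := by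
    intro a b; apply Continuous.intervalIntegrable; fun_prop
  have hn' : (n : ℂ) ≠ 0 := by exact_mod_cast hn
  rw [← intervalIntegral.integral_add_adjacent_intervals (hi (-Real.pi) (-t)) (hi (-t) Real.pi),
    ← intervalIntegral.integral_add_adjacent_intervals (hi (-t) 0) (hi 0 Real.pi),
    ← intervalIntegral.integral_add_adjacent_intervals (hi 0 t) (hi t Real.pi)]
  have e1 : ∫ x in (-Real.pi)..(-t), (tri t x : ℂ) * Complex.exp (-Complex.I * n * x) = 0 := by
    rw [intervalIntegral.integral_congr (g := fun _ => 0)]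
    · simp
    · intro x hx
      rw [Set.uIcc_of_le (by linarith)] at hx
      have : tri t x = 0 := by
        unfold tri; rw [max_eq_right]; linarith [neg_le_abs x, hx.2]
      simp [this]
  have e4 : ∫ x in t..Real.pi, (tri t x : ℂ) * Complex.exp (-Complex.I * n * x) = 0 := by
    rw [intervalIntegral.integral_congr (g := fun _ => 0)]
    · simp
    · intro x hx
      rw [Set.uIcc_of_le (by linarith)] at hx
      have : tri t x = 0 := by
        unfold tri; rw [max_eq_right]; linarith [le_abs_self x, hx.1]
      simp [this]
  have e2 : ∫ x in (-t)..0, (tri t x : ℂ) * Complex.exp (-Complex.I * n * x) =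
      ∫ x in (-t)..0, ((t + 1 * x : ℝ) : ℂ) * Complex.exp (-Complex.I * n * x) := by
    apply intervalIntegral.integral_congr
    intro x hx
    rw [Set.uIcc_of_le (by linarith)] at hx
    have : tri t x = t + 1 * x := by
      unfold tri; rw [abs_of_nonpos hx.2, max_eq_left]
      · ring
      · linarith [hx.1]
    simp only [this]
  have e3 : ∫ x in 0..t, (tri t x : ℂ) * Complex.exp (-Complex.I * n * x) =
      ∫ x in 0..t, ((t + (-1) * x : ℝ) : ℂ) * Complex.exp (-Complex.I * n * x) := by
    apply intervalIntegral.integral_congr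
    intro x hx
    rw [Set.uIcc_of_le (by linarith)] at hx
    have : tri t x = t + (-1) * x := by
      unfold tri; rw [abs_of_nonneg hx.1, max_eq_left]
      · ring
      · linarith [hx.2]
    simp only [this]
  rw [e1, e4, e2, e3, piece _ _ _ _ _ hn', piece _ _ _ _ _ hn']
  push_cast
  rw [Complex.cos]
  rw [show -Complex.I * n * -(t:ℂ) = n * t * Complex.I by ring,
    show -Complex.I * n * (t:ℂ) = -(n * t) * Complex.I by ring]
  simp only [mul_zero, Complex.exp_zero]
  field_simp
  ring

lemma coeff_eq (c d : ℝ) (hc : 0 ≤ c) (hcd : c < d) (hd : d ≤ Real.pi) (n : ℤ) (hn : n ≠ 0) :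
    trapCoeff (-d) (-c) c d n =
      (((Real.cos (n * c) - Real.cos (n * d)) / n ^ 2 / (Real.pi * (d - c)) : ℝ) : ℂ) := by
  have hp := Real.pi_pos
  have h1 := tri_int d (by linarith) hd n hn
  have h2 := tri_int c hc (by linarith) n hn
  have hct := tri_cont c
  have hdt := tri_cont d
  have : ∀ x : ℝ, (trap (-d) (-c) c d x : ℂ) * Complex.exp (-Complex.I * n * x) =
      ((d - c : ℝ) : ℂ)⁻¹ * ((tri d x : ℂ) * Complex.exp (-Complex.I * n * x) -
       (tri c x : ℂ) * Complex.exp (-Complex.I * n * x)) := by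
    intro x
    rw [trap_eq _ _ _ hc hcd]
    push_cast
    ring
  unfold trapCoeff
  simp only [this]
  rw [intervalIntegral.integral_const_mul, intervalIntegral.integral_sub, h1, h2]
  · rw [← Complex.ofReal_sub, ← Complex.ofReal_inv, ← Complex.ofReal_mul]
    rw [show (2 * (Real.pi : ℂ))⁻¹ = (((2 * Real.pi)⁻¹ : ℝ) : ℂ) by push_cast; rfl,
      ← Complex.ofReal_mul]
    congr 1
    have : d - c ≠ 0 := by linarith
    have : (n : ℝ) ≠ 0 := by exact_mod_cast hn
    field_simp
    ring
  · apply Continuous.intervalIntegrable; fun_prop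
  · apply Continuous.intervalIntegrable; fun_prop

lemma cos_lip (x y : ℝ) : |Real.cos x - Real.cos y| ≤ |x - y| := by
  exact Real.abs_cos_sub_cos_le x y

lemma high (C c d : ℝ) (hc : 0 ≤ c) (hcd : c < d) (hd : d ≤ Real.pi)
    (hC1 : 1 ≤ C) (hC : d ≤ C * (d - c)) (n : ℕ) (hn : 1 ≤ n) :
    ‖trapCoeff (-d) (-c) c d (n + 1) - trapCoeff (-d) (-c) c d n‖ ≤ 4 * C / n ^ 2 := by
  have hp := Real.pi_gt_three
  have h0 : 0 < d - c := by linarith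
  rw [coeff_eq c d hc hcd hd _ (by omega), coeff_eq c d hc hcd hd _ (by omega),
    ← Complex.ofReal_sub, Complex.norm_real, Real.norm_eq_abs, ← sub_div, abs_div,
    abs_of_pos (by positivity : 0 < Real.pi * (d - c)), div_le_iff₀ (by positivity)]
  push_cast
  have hn' : (1:ℝ) ≤ n := by exact_mod_cast hn
  generalize (n:ℝ) = m at *
  have hm : 0 < m := by linarith
  have g1 := cos_lip ((m + 1) * c) (m * c)
  have g2 := cos_lip ((m + 1) * d) (m * d)
  have g3 := cos_lip (m * c) (m * d)
  rw [show (m + 1) * c - m * c = c by ring, abs_of_nonneg hc] at g1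
  rw [show (m + 1) * d - m * d = d by ring, abs_of_pos (by linarith : 0 < d)] at g2
  rw [show m * c - m * d = -(m * (d - c)) by ring, abs_neg,
    abs_of_pos (by positivity : 0 < m * (d - c))] at g3
  generalize Real.cos ((m + 1) * c) = A at *
  generalize Real.cos ((m + 1) * d) = B at *
  generalize Real.cos (m * c) = A' at *
  generalize Real.cos (m * d) = B' at *
  have e : (A - B) / (m + 1) ^ 2 - (A' - B') / m ^ 2 =
    ((A - A') - (B - B')) / (m + 1) ^ 2 - (A' - B') * ((2 * m + 1) / (m ^ 2 * (m + 1) ^ 2)) := by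
    field_simp; ring
  rw [e]
  have k1 : |((A - A') - (B - B')) / (m + 1) ^ 2| ≤ 2 * d / m ^ 2 := by
    rw [abs_div, abs_of_pos (by positivity : 0 < (m+1)^2)]
    have : |(A - A') - (B - B')| ≤ 2 * d := (abs_sub _ _).trans (by linarith)
    gcongr
    · linarith
    · linarith
  have k2 : |(A' - B') * ((2 * m + 1) / (m ^ 2 * (m + 1) ^ 2))| ≤ 2 * (d - c) / m ^ 2 := by
    rw [abs_mul, abs_of_pos (by positivity : 0 < (2 * m + 1) / (m ^ 2 * (m + 1) ^ 2))]
    calc _ ≤ m * (d - c) * ((2 * m + 1) / (m ^ 2 * (m + 1) ^ 2)) := by gcongr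
      _ = (d - c) / m ^ 2 * ((m * (2 * m + 1)) / (m + 1) ^ 2) := by field_simp
      _ ≤ (d - c) / m ^ 2 * 2 := by
        gcongr
        rw [div_le_iff₀ (by positivity)]; nlinarith
      _ = _ := by ring
  calc _ ≤ 2 * d / m ^ 2 + 2 * (d - c) / m ^ 2 := (abs_sub _ _).trans (add_le_add k1 k2)
    _ = (2 * d + 2 * (d - c)) / m ^ 2 := by ring
    _ ≤ (4 * C * (Real.pi * (d - c))) / m ^ 2 := by
        gcongr
        have : d - c ≤ C * (d - c) := by nlinarith
        have : C * (d - c) * 1 ≤ C * (d - c) * Real.pi := by gcongr; linarith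
        nlinarith
    _ = _ := by ring

lemma combined (C c d : ℝ) (hc : 0 ≤ c) (hcd : c < d) (hd : d ≤ Real.pi)
    (hC1 : 1 ≤ C) (hC : d ≤ C * (d - c)) (n : ℕ) :
    ‖trapCoeff (-d) (-c) c d (n + 1) - trapCoeff (-d) (-c) c d n‖ ≤
      48 * C * (d / (n * d + 1) - d / ((n + 1 : ℕ) * d + 1)) := by
  have hd0 : 0 < d := by linarith
  have e : d / (n * d + 1) - d / ((n + 1 : ℕ) * d + 1) =
      d ^ 2 / ((n * d + 1) * ((n + 1) * d + 1)) := by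
    push_cast
    field_simp
    ring
  rw [e]
  have hp := Real.pi_lt_d2
  by_cases h : (n : ℝ) * d ≤ 1
  · apply (low c d hc hcd hd n).trans
    rw [← mul_div_assoc, le_div_iff₀ (by positivity)]
    have : ((n * d + 1) * ((n + 1) * d + 1)) ≤ (2 : ℝ) * 6 := by
      gcongr
      · linarith
      · linarith
    have h3 : ((n * d + 1) * ((n + 1) * d + 1)) ≤ 48 * C := by linarith
    calc _ ≤ d ^ 2 * (48 * C) := by gcongr
      _ = _ := by ring
  · push Not at h
    have hn : 1 ≤ n := by
      rcases Nat.eq_zero_or_pos n with h0 | h0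
      · subst h0; norm_num at h
      · exact h0
    apply (high C c d hc hcd hd hC1 hC n hn).trans
    have hn' : (1:ℝ) ≤ n := by exact_mod_cast hn
    rw [← mul_div_assoc, div_le_div_iff₀ (by positivity) (by positivity)]
    have : ((n * d + 1) * ((n + 1) * d + 1)) ≤ (2 * (n * d)) * (3 * (n * d)) := by
      gcongr
      · linarith
      · nlinarith
    calc _ ≤ 4 * C * ((2 * (n * d)) * (3 * (n * d))) := by gcongr
      _ ≤ 48 * C * d ^ 2 * n ^ 2 := by
        have : 0 ≤ C * d ^ 2 * (n:ℝ) ^ 2 := by positivity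
        nlinarith

/-- For a symmetric trapezoid `η(−d,−c,c,d)` with `d ≤ C(d−c)`, the total variation
of the sequence of its Fourier coefficients is at most `C'·d`. -/
theorem stmt_12 : ∀ C : ℝ, 1 ≤ C → ∃ C' > (0 : ℝ), ∀ c d : ℝ,
    0 ≤ c → c < d → d ≤ Real.pi → d ≤ C * (d - c) →
    ∑' k : ℤ, ‖trapCoeff (-d) (-c) c d (k + 1) - trapCoeff (-d) (-c) c d k‖ ≤ C' * d := by
  intro C hC1
  refine ⟨96 * C, by linarith, ?_⟩
  intro c d hc hcd hd hC
  have hd0 : 0 < d := by linarith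
  set f : ℤ → ℝ := fun k => ‖trapCoeff (-d) (-c) c d (k + 1) - trapCoeff (-d) (-c) c d k‖ with hf
  have hs : ∀ n : ℕ, f (-(n + 1)) = f n := by
    intro n
    simp only [hf]
    rw [show (-((n:ℤ) + 1) + 1) = -(n:ℤ) by ring, coeff_even _ _ hc hcd, coeff_even _ _ hc hcd,
      norm_sub_rev]
  have hb : ∀ N : ℕ, ∑ i ∈ Finset.range N, f i ≤ 48 * C * d := by
    intro N
    calc _ ≤ ∑ i ∈ Finset.range N,
          48 * C * (d / ((i:ℕ) * d + 1) - d / ((i + 1 : ℕ) * d + 1)) :=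
          Finset.sum_le_sum fun i _ => combined C c d hc hcd hd hC1 hC i
      _ = 48 * C * (d - d / (N * d + 1)) := by
          rw [← Finset.mul_sum, Finset.sum_range_sub' (fun i : ℕ => d / ((i:ℝ) * d + 1))]
          simp
      _ ≤ 48 * C * d := by
          have : 0 ≤ d / (N * d + 1) := by positivity
          gcongr
          linarith
  have hnn : ∀ n : ℕ, 0 ≤ f n := fun n => norm_nonneg _
  have hsum : Summable (fun n : ℕ => f n) := summable_of_sum_range_le hnn hb
  have hle := Real.tsum_le_of_sum_range_le hnn hb
  have hsum' : Summable (fun n : ℕ => f (-(n + 1))) := by simpa only [hs] using hsum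
  rw [tsum_of_nat_of_neg_add_one hsum hsum']
  simp only [hs]
  linarith
end

section
/- Let G be a function on the circle with absolutely convergent Fourier series, μ a finite Borel measure on the circle, 1 ≤ q < ∞, and let η be a symmetric trapezoid η(−a,−b,b,a) with 0 < b < a ≤ 1 and 2^{20}(a−b) > b. Then ∫ |(1/(a+b)) G * η|^q dμ ≤ C^q · sup_n ∫ |S_n(G)|^q dμ, for an absolute constant C (where the sup is over partial Fourier sums). -/
open MeasureTheory intervalIntegral

/-- The `2π`-periodization of the trapezoid (a function on the circle). -/
noncomputable def trapP (a b c d x : ℝ) : ℝ := ∑' m : ℤ, trap a b c d (x + 2 * Real.pi * m)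

lemma jensen_int {ι : Type*} (s : Finset ι) (α : ι → ℂ) (f : ι → ℝ → ℂ) (μ : Measure ℝ)
    (q : ℝ) (hq : 1 ≤ q) (K C : ℝ) (hint : ∀ i ∈ s, Integrable (fun x => ‖f i x‖ ^ q) μ)
    (hK : ∀ i ∈ s, ∫ x, ‖f i x‖ ^ q ∂μ ≤ K) (hK0 : 0 ≤ K) (hC : ∑ i ∈ s, ‖α i‖ ≤ C) :
    ∫ x, ‖∑ i ∈ s, α i * f i x‖ ^ q ∂μ ≤ C ^ q * K := by
  set A := ∑ i ∈ s, ‖α i‖ with hA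
  have hA0 : 0 ≤ A := Finset.sum_nonneg fun i _ => norm_nonneg _
  have hCA : A ^ q * K ≤ C ^ q * K :=
    mul_le_mul_of_nonneg_right (Real.rpow_le_rpow hA0 hC (by linarith)) hK0
  refine le_trans ?_ hCA
  rcases hA0.eq_or_lt with h0 | hpos
  · have hz : ∀ i ∈ s, α i = 0 := by
      have := (Finset.sum_eq_zero_iff_of_nonneg (fun i _ => norm_nonneg (α i))).1 h0.symm
      intro i hi
      simpa using this i hi
    have : ∀ x, ∑ i ∈ s, α i * f i x = 0 := fun x =>
      Finset.sum_eq_zero fun i hi => by simp [hz i hi]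
    have hq0 : q ≠ 0 := by linarith
    simp only [this, norm_zero, Real.zero_rpow hq0, integral_zero]
    positivity
  · have hpt : ∀ x, ‖∑ i ∈ s, α i * f i x‖ ^ q ≤
        A ^ q * ∑ i ∈ s, (‖α i‖ / A) * ‖f i x‖ ^ q := by
      intro x
      have h1 : ‖∑ i ∈ s, α i * f i x‖ ≤ A * ∑ i ∈ s, (‖α i‖ / A) * ‖f i x‖ := by
        refine (norm_sum_le _ _).trans (le_of_eq ?_)
        rw [Finset.mul_sum]
        refine Finset.sum_congr rfl fun i _ => ?_
        rw [norm_mul]; field_simp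
      have h2 := Real.rpow_arith_mean_le_arith_mean_rpow s (fun i => ‖α i‖ / A)
        (fun i => ‖f i x‖) (fun i _ => by positivity)
        (by rw [← Finset.sum_div]; exact div_self hpos.ne') (fun i _ => norm_nonneg _) hq
      calc _ ≤ (A * ∑ i ∈ s, (‖α i‖ / A) * ‖f i x‖) ^ q :=
            Real.rpow_le_rpow (norm_nonneg _) h1 (by linarith)
        _ = A ^ q * (∑ i ∈ s, (‖α i‖ / A) * ‖f i x‖) ^ q :=
            Real.mul_rpow hA0 (Finset.sum_nonneg fun i _ => by positivity)
        _ ≤ _ := by gcongr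
    have hi2 : ∀ i ∈ s, Integrable (fun x => (‖α i‖ / A) * ‖f i x‖ ^ q) μ :=
      fun i hi => (hint i hi).const_mul _
    calc _ ≤ ∫ x, A ^ q * ∑ i ∈ s, (‖α i‖ / A) * ‖f i x‖ ^ q ∂μ := by
          refine integral_mono_of_nonneg (Filter.Eventually.of_forall fun x => by positivity) ?_
            (Filter.Eventually.of_forall hpt)
          exact (integrable_finsetSum s hi2).const_mul _
      _ = A ^ q * ∑ i ∈ s, (‖α i‖ / A) * ∫ x, ‖f i x‖ ^ q ∂μ := by
          rw [MeasureTheory.integral_const_mul, integral_finsetSum s hi2]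
          simp only [MeasureTheory.integral_const_mul]
      _ ≤ A ^ q * ∑ i ∈ s, (‖α i‖ / A) * K := by
          gcongr with i hi
          exact hK i hi
      _ = A ^ q * K := by
          rw [← Finset.sum_mul, ← Finset.sum_div, ← hA, div_self hpos.ne', one_mul]

lemma trap_eq_s14 {a b : ℝ} (hb : 0 < b) (hab : b < a) (t : ℝ) :
    trap (-a) (-b) b a t = (max 0 (a - |t|) - max 0 (b - |t|)) / (a - b) := by
  have h : a - b ≠ 0 := by linarith
  unfold trap
  split_ifs with h1 h2 h3 h4
  · rw [abs_of_neg (by linarith), max_eq_left (by linarith), max_eq_left (by linarith)]; simp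
  · rw [abs_of_neg (by linarith), max_eq_right (by linarith), max_eq_left (by linarith)]
    congr 1 <;> ring
  · have : |t| ≤ b := abs_le.2 ⟨by linarith, h3⟩
    rw [max_eq_right (by linarith), max_eq_right (by linarith)]
    field_simp; ring
  · rw [abs_of_pos (by linarith), max_eq_right (by linarith), max_eq_left (by linarith)]
    simp
  · rw [abs_of_pos (by linarith), max_eq_left (by linarith), max_eq_left (by linarith)]; simp

lemma trap_cont_s14 {a b : ℝ} (hb : 0 < b) (hab : b < a) : Continuous (trap (-a) (-b) b a) := by
  have : trap (-a) (-b) b a = fun t => (max 0 (a - |t|) - max 0 (b - |t|)) / (a - b) :=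
    funext (trap_eq_s14 hb hab)
  rw [this]; fun_prop

lemma trap_even_s14 {a b : ℝ} (hb : 0 < b) (hab : b < a) (t : ℝ) :
    trap (-a) (-b) b a (-t) = trap (-a) (-b) b a t := by
  rw [trap_eq_s14 hb hab, trap_eq_s14 hb hab, abs_neg]

lemma trap_nonneg {a b : ℝ} (hb : 0 < b) (hab : b < a) (t : ℝ) :
    0 ≤ trap (-a) (-b) b a t := by
  rw [trap_eq_s14 hb hab]
  apply div_nonneg _ (by linarith)
  have : max 0 (b - |t|) ≤ max 0 (a - |t|) := by gcongr
  linarith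

lemma trap_zero {a b : ℝ} (hb : 0 < b) (hab : b < a) {t : ℝ} (h : a ≤ |t|) :
    trap (-a) (-b) b a t = 0 := by
  rw [trap_eq_s14 hb hab, max_eq_left (by linarith), max_eq_left (by linarith)]; simp

lemma trap_le_one {a b : ℝ} (hb : 0 < b) (hab : b < a) (t : ℝ) :
    trap (-a) (-b) b a t ≤ 1 := by
  rw [trap_eq_s14 hb hab, div_le_one (by linarith)]
  have h1 : max 0 (a - |t|) ≤ max 0 (b - |t|) + (a - b) := by
    apply max_le
    · have := le_max_left 0 (b - |t|); linarith
    · have := le_max_right 0 (b - |t|); linarith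
  linarith

lemma tent_int {c : ℝ} (hc : 0 < c) (hc1 : c ≤ 1) (φ : ℝ → ℝ) (hφ : Continuous φ)
    (hev : ∀ t, φ (-t) = φ t) :
    ∫ t in (-Real.pi)..Real.pi, φ t * max 0 (c - |t|) = 2 * ∫ t in (0:ℝ)..c, φ t * (c - t) := by
  have hcont : Continuous fun t => φ t * max 0 (c - |t|) := by fun_prop
  have hpi := Real.pi_gt_three
  rw [← integral_add_adjacent_intervals (b := 0) (hcont.intervalIntegrable _ _)
    (hcont.intervalIntegrable _ _)]
  have h1 : ∫ t in (-Real.pi)..0, φ t * max 0 (c - |t|) =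
      ∫ t in (0:ℝ)..Real.pi, φ t * max 0 (c - |t|) := by
    have := intervalIntegral.integral_comp_neg (a := 0) (b := Real.pi)
      (fun t => φ t * max 0 (c - |t|))
    simp only [hev, abs_neg, neg_zero] at this
    exact this.symm
  rw [h1, ← integral_add_adjacent_intervals (a := 0) (b := c) (c := Real.pi)
    (hcont.intervalIntegrable _ _) (hcont.intervalIntegrable _ _)]
  have h2 : ∫ t in (0:ℝ)..c, φ t * max 0 (c - |t|) = ∫ t in (0:ℝ)..c, φ t * (c - t) := by
    apply intervalIntegral.integral_congr
    intro t ht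
    rw [Set.uIcc_of_le hc.le] at ht
    simp only
    rw [abs_of_nonneg ht.1, max_eq_right (by linarith [ht.2])]
  have h3 : ∫ t in c..Real.pi, φ t * max 0 (c - |t|) = 0 := by
    refine Eq.trans (intervalIntegral.integral_congr (g := fun _ => (0:ℝ)) ?_) (by simp)
    intro t ht
    rw [Set.uIcc_of_le (by linarith)] at ht
    simp only
    rw [abs_of_nonneg (by linarith [ht.1]), max_eq_left (by linarith [ht.1])]
    simp
  rw [h2, h3]; ring

lemma tent_cos {c : ℝ} (hc : 0 < c) (hc1 : c ≤ 1) {k : ℝ} (hk : k ≠ 0) :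
    ∫ t in (-Real.pi)..Real.pi, Real.cos (k * t) * max 0 (c - |t|) =
      2 * (1 - Real.cos (k * c)) / k ^ 2 := by
  rw [tent_int hc hc1 (fun t => Real.cos (k * t)) (by fun_prop) (by intro t; simp)]
  have : ∫ t in (0:ℝ)..c, Real.cos (k * t) * (c - t) =
      ((c - c) * Real.sin (k * c) / k - Real.cos (k * c) / k ^ 2) -
      ((c - 0) * Real.sin (k * 0) / k - Real.cos (k * 0) / k ^ 2) := by
    apply intervalIntegral.integral_eq_sub_of_hasDerivAt
      (f := fun t => (c - t) * Real.sin (k * t) / k - Real.cos (k * t) / k ^ 2)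
    · intro t _
      have h1 : HasDerivAt (fun t : ℝ => k * t) k t := by
        simpa using (hasDerivAt_id t).const_mul k
      have h2 : HasDerivAt (fun t : ℝ => c - t) (-1) t := by
        simpa using (hasDerivAt_id t).const_sub c
      refine (((h2.mul h1.sin).div_const k).sub (h1.cos.div_const (k ^ 2))).congr_deriv ?_
      field_simp; ring
    · apply Continuous.intervalIntegrable; fun_prop
  rw [this]; simp; ring

lemma tent_one {c : ℝ} (hc : 0 < c) (hc1 : c ≤ 1) :
    ∫ t in (-Real.pi)..Real.pi, max 0 (c - |t|) = c ^ 2 := by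
  have := tent_int hc hc1 (fun _ => 1) (by fun_prop) (by intro t; simp)
  simp only [one_mul] at this
  rw [this]
  have h : ∫ t in (0:ℝ)..c, (c - t) = c * c - c ^ 2 / 2 := by
    rw [intervalIntegral.integral_sub (by simp) (by simp)]
    simp
  rw [h]
  ring

/-- cosine transform of the trapezoid -/
noncomputable def hh (a b k : ℝ) : ℝ :=
  ∫ t in (-Real.pi)..Real.pi, Real.cos (k * t) * trap (-a) (-b) b a t

lemma hh_split {a b : ℝ} (hb : 0 < b) (hab : b < a) (k : ℝ) :
    hh a b k = ((∫ t in (-Real.pi)..Real.pi, Real.cos (k * t) * max 0 (a - |t|)) -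
      ∫ t in (-Real.pi)..Real.pi, Real.cos (k * t) * max 0 (b - |t|)) / (a - b) := by
  unfold hh
  rw [← intervalIntegral.integral_sub, ← intervalIntegral.integral_div]
  · congr 1; ext t; rw [trap_eq_s14 hb hab]; ring
  · apply Continuous.intervalIntegrable; fun_prop
  · apply Continuous.intervalIntegrable; fun_prop

lemma hh_formula {a b : ℝ} (hb : 0 < b) (hab : b < a) (ha : a ≤ 1) {k : ℝ} (hk : k ≠ 0) :
    hh a b k = 2 / (a - b) * ((Real.cos (k * b) - Real.cos (k * a)) / k ^ 2) := by
  rw [hh_split hb hab, tent_cos (by linarith) ha hk, tent_cos hb (by linarith) hk]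
  have : a - b ≠ 0 := by linarith
  field_simp; ring

lemma trap_int {a b : ℝ} (hb : 0 < b) (hab : b < a) (ha : a ≤ 1) :
    ∫ t in (-Real.pi)..Real.pi, trap (-a) (-b) b a t = a + b := by
  have := hh_split hb hab 0
  unfold hh at this
  simp only [zero_mul, Real.cos_zero, one_mul] at this
  rw [this, tent_one (by linarith) ha, tent_one hb (by linarith)]
  have : a - b ≠ 0 := by linarith
  field_simp; ring

lemma hh_bound {a b : ℝ} (hb : 0 < b) (hab : b < a) (ha : a ≤ 1) (k : ℝ) :
    |hh a b k| ≤ a + b := by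
  have hpi := Real.pi_pos
  rw [← trap_int hb hab ha, ← Real.norm_eq_abs]
  have hc := trap_cont_s14 hb hab
  apply intervalIntegral.norm_integral_le_of_norm_le (by linarith)
  · refine Filter.Eventually.of_forall fun t _ => ?_
    rw [norm_mul, Real.norm_eq_abs, Real.norm_eq_abs, abs_of_nonneg (trap_nonneg hb hab t)]
    exact mul_le_of_le_one_left (trap_nonneg hb hab t) (Real.abs_cos_le_one _)
  · exact hc.intervalIntegrable _ _

lemma hh_diff1 {a b : ℝ} (hb : 0 < b) (hab : b < a) (ha : a ≤ 1) (k : ℝ) :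
    |hh a b k - hh a b (k + 1)| ≤ a * (a + b) := by
  have hpi := Real.pi_pos
  have hc := trap_cont_s14 hb hab
  rw [← trap_int hb hab ha, ← Real.norm_eq_abs, ← intervalIntegral.integral_const_mul]
  unfold hh
  rw [← intervalIntegral.integral_sub]
  · apply intervalIntegral.norm_integral_le_of_norm_le (by linarith)
    · refine Filter.Eventually.of_forall fun t _ => ?_
      rw [← sub_mul, norm_mul, Real.norm_eq_abs, Real.norm_eq_abs,
        abs_of_nonneg (trap_nonneg hb hab t)]
      by_cases h : a ≤ |t|
      · rw [trap_zero hb hab h]; simp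
      · refine mul_le_mul_of_nonneg_right ?_ (trap_nonneg hb hab t)
        refine (Real.abs_cos_sub_cos_le _ _).trans ?_
        rw [show k * t - (k + 1) * t = -t by ring, abs_neg]
        linarith
    · apply Continuous.intervalIntegrable; fun_prop
  · apply Continuous.intervalIntegrable; fun_prop
  · apply Continuous.intervalIntegrable; fun_prop

lemma hh_diff2 {a b : ℝ} (hb : 0 < b) (hab : b < a) (ha : a ≤ 1) {n : ℝ} (hn : 1 / a ≤ n) :
    |hh a b n - hh a b (n + 1)| ≤ 24 * a / (a - b) * (1 / n - 1 / (n + 1)) := by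
  have ha0 : 0 < a := by linarith
  have hn1 : 1 ≤ n := le_trans (by rw [le_div_iff₀ ha0]; linarith) hn
  have hn0 : 0 < n := by linarith
  have hd : 0 < a - b := by linarith
  have han : 1 / n ≤ a := by
    rw [div_le_iff₀ hn0]; rw [div_le_iff₀ ha0] at hn; linarith
  rw [hh_formula hb hab ha hn0.ne', hh_formula hb hab ha (by linarith), ← mul_sub, abs_mul,
    abs_of_pos (by positivity)]
  set x := Real.cos (n * b) - Real.cos (n * a) with hx
  set y := Real.cos ((n + 1) * b) - Real.cos ((n + 1) * a) with hy
  have hxy : |x - y| ≤ 2 * a := by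
    have h1 := Real.abs_cos_sub_cos_le (n * b) ((n + 1) * b)
    have h2 := Real.abs_cos_sub_cos_le ((n + 1) * a) (n * a)
    rw [show n * b - (n + 1) * b = - b by ring, abs_neg, abs_of_pos hb] at h1
    rw [show (n + 1) * a - n * a = a by ring, abs_of_pos ha0] at h2
    have : x - y = (Real.cos (n * b) - Real.cos ((n + 1) * b)) +
      (Real.cos ((n + 1) * a) - Real.cos (n * a)) := by rw [hx, hy]; ring
    rw [this]
    refine (abs_add_le _ _).trans ?_
    linarith
  have hy2 : |y| ≤ 2 := by
    refine (abs_sub _ _).trans ?_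
    linarith [Real.abs_cos_le_one ((n + 1) * b), Real.abs_cos_le_one ((n + 1) * a)]
  have e : x / n ^ 2 - y / (n + 1) ^ 2 = (x - y) * (1 / n ^ 2) +
      y * (1 / n ^ 2 - 1 / (n + 1) ^ 2) := by field_simp; ring
  have hz : 1 / n ^ 2 - 1 / (n + 1) ^ 2 ≤ 2 * a * (1 / n ^ 2) := by
    have : 1 / n ^ 2 - 1 / (n + 1) ^ 2 ≤ 2 * (1 / n) * (1 / n ^ 2) := by
      have : 2 * (1 / n) * (1 / n ^ 2) - (1 / n ^ 2 - 1 / (n + 1) ^ 2) =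
        (3 * n + 2) / (n ^ 3 * (n + 1) ^ 2) := by field_simp; ring
      have h : 0 ≤ (3 * n + 2) / (n ^ 3 * (n + 1) ^ 2) := by positivity
      linarith
    refine this.trans ?_
    gcongr
  have hz0 : 0 ≤ 1 / n ^ 2 - 1 / (n + 1) ^ 2 := by
    rw [sub_nonneg]; gcongr; linarith
  have hs : 1 / n ^ 2 ≤ 2 * (1 / n - 1 / (n + 1)) := by
    have : 2 * (1 / n - 1 / (n + 1)) - 1 / n ^ 2 = (n - 1) / (n ^ 2 * (n + 1)) := by
      field_simp; ring
    have h : 0 ≤ (n - 1) / (n ^ 2 * (n + 1)) := div_nonneg (by linarith) (by positivity)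
    linarith
  have key : |x / n ^ 2 - y / (n + 1) ^ 2| ≤ 6 * a * (1 / n ^ 2) := by
    rw [e]
    refine (abs_add_le _ _).trans ?_
    rw [abs_mul, abs_mul, abs_of_nonneg hz0, abs_of_nonneg (by positivity : 0 ≤ 1 / n ^ 2)]
    have h1 : |x - y| * (1 / n ^ 2) ≤ 2 * a * (1 / n ^ 2) := by gcongr
    have h2 : |y| * (1 / n ^ 2 - 1 / (n + 1) ^ 2) ≤ 2 * (2 * a * (1 / n ^ 2)) :=
      mul_le_mul hy2 hz hz0 (by norm_num)
    linarith
  calc _ ≤ 2 / (a - b) * (6 * a * (2 * (1 / n - 1 / (n + 1)))) := by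
        refine mul_le_mul_of_nonneg_left (key.trans ?_) (by positivity)
        gcongr
    _ = _ := by ring

lemma sum_diff {a b : ℝ} (hb : 0 < b) (hab : b < a) (ha : a ≤ 1) (h20 : b < 2 ^ 20 * (a - b))
    (m : ℕ) : ∑ n ∈ Finset.range m, |hh a b n - hh a b ((n + 1 : ℕ) : ℝ)| ≤
      (2 ^ 25 - 1) * (a + b) := by
  have ha0 : 0 < a := by linarith
  have hd : 0 < a - b := by linarith
  set N := ⌈1 / a⌉₊ with hN
  have hN1 : 1 / a ≤ N := Nat.le_ceil _
  have hN0 : (0:ℝ) < N := lt_of_lt_of_le (by positivity) hN1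
  have hN2 : (N : ℝ) < 1 / a + 1 := Nat.ceil_lt_add_one (by positivity)
  have haN : a * N ≤ 2 := by
    have : a * N ≤ a * (1 / a + 1) := by gcongr
    rw [mul_add, mul_one_div_cancel ha0.ne'] at this; linarith
  have hiN : 1 / (N:ℝ) ≤ a := by
    rw [div_le_iff₀ hN0]; rw [div_le_iff₀ ha0] at hN1; linarith
  have hM : 24 * a / (a - b) * (1 / N) ≤ 24 * (2 ^ 20 + 1) * (a + b) := by
    have h1 : a / (a - b) ≤ 2 ^ 20 + 1 := by
      rw [div_le_iff₀ hd]; linarith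
    calc 24 * a / (a - b) * (1 / N) = 24 * (a / (a - b)) * (1 / N) := by ring
      _ ≤ 24 * (2 ^ 20 + 1) * (a + b) := by
        gcongr
        linarith
  have hsmall : ∀ m : ℕ, ∑ n ∈ Finset.range m, |hh a b n - hh a b ((n + 1 : ℕ) : ℝ)| ≤
      a * (a + b) * m := by
    intro m
    calc _ ≤ ∑ n ∈ Finset.range m, a * (a + b) := by
          apply Finset.sum_le_sum; intro n _; push_cast; exact hh_diff1 hb hab ha n
      _ = _ := by simp; ring
  have hs2 : a * (a + b) * N ≤ 2 * (a + b) := by nlinarith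
  rcases le_total m N with h | h
  · have : a * (a + b) * m ≤ a * (a + b) * N := by gcongr
    have := hsmall m
    nlinarith
  · have : ∑ n ∈ Finset.range m, |hh a b n - hh a b ((n + 1 : ℕ) : ℝ)| ≤
        a * (a + b) * N + 24 * a / (a - b) * (1 / N - 1 / m) := by
      induction m, h using Nat.le_induction with
      | base => simpa using hsmall N
      | succ m hm ih =>
        rw [Finset.sum_range_succ]
        have hmN : (N : ℝ) ≤ m := by exact_mod_cast hm
        have := hh_diff2 hb hab ha (hN1.trans hmN)
        push_cast at *
        linarith
    have hm0 : 0 ≤ 24 * a / (a - b) * (1 / (m:ℝ)) := by positivity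
    nlinarith
lemma trapP_periodic (a b c d : ℝ) : Function.Periodic (trapP a b c d) (2 * Real.pi) := by
  intro x
  unfold trapP
  rw [← (Equiv.addRight (1:ℤ)).tsum_eq (fun m : ℤ => trap a b c d (x + 2 * Real.pi * m))]
  refine tsum_congr fun m => ?_
  congr 1
  simp
  ring

lemma trapP_eq {a b : ℝ} (hb : 0 < b) (hab : b < a) (ha : a ≤ 1) {t : ℝ} (ht : |t| ≤ Real.pi) :
    trapP (-a) (-b) b a t = trap (-a) (-b) b a t := by
  unfold trapP
  rw [tsum_eq_single 0]
  · simp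
  · intro m hm
    apply trap_zero hb hab
    have hpi := Real.pi_gt_three
    have h1 : (1:ℝ) ≤ |(m:ℝ)| := by exact_mod_cast Int.one_le_abs hm
    have h2 : |2 * Real.pi * m| = 2 * Real.pi * |(m:ℝ)| := by
      rw [abs_mul, abs_of_pos (by linarith)]
    have h3 : |2 * Real.pi * m| ≤ |t + 2 * Real.pi * m| + |t| := by
      have := abs_sub (t + 2 * Real.pi * m) t
      simpa using this
    nlinarith

lemma exp_int {a b : ℝ} (hb : 0 < b) (hab : b < a) (k : ℤ) :
    ∫ t in (-Real.pi)..Real.pi, Complex.exp (Complex.I * k * ((-t : ℝ) : ℂ)) *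
      (trap (-a) (-b) b a t : ℂ) = (hh a b k : ℂ) := by
  have hc := trap_cont_s14 hb hab
  have hc' : Continuous fun t => (trap (-a) (-b) b a t : ℂ) :=
    Complex.continuous_ofReal.comp hc
  set f : ℝ → ℂ := fun t => Complex.exp (Complex.I * k * ((-t : ℝ) : ℂ)) *
      (trap (-a) (-b) b a t : ℂ) with hf
  have hfc : Continuous f := by rw [hf]; fun_prop
  have hfc' : Continuous fun t => f (-t) := hfc.comp continuous_neg
  have h1 : ∫ t in (-Real.pi)..Real.pi, f (-t) = ∫ t in (-Real.pi)..Real.pi, f t := by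
    rw [intervalIntegral.integral_comp_neg]; simp
  have h2 : (∫ t in (-Real.pi)..Real.pi, f t) + ∫ t in (-Real.pi)..Real.pi, f (-t) =
      2 * (hh a b k : ℂ) := by
    rw [← intervalIntegral.integral_add (hfc.intervalIntegrable _ _)
      (hfc'.intervalIntegrable _ _)]
    unfold hh
    rw [← intervalIntegral.integral_ofReal, ← intervalIntegral.integral_const_mul]
    congr 1
    ext t
    simp only [hf, trap_even_s14 hb hab]
    push_cast
    rw [Complex.cos]
    rw [show Complex.I * k * -(t:ℂ) = -((k:ℂ) * t) * Complex.I by ring,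
      show Complex.I * k * -(-(t:ℂ)) = ((k:ℂ) * t) * Complex.I by ring]
    ring
  rw [h1] at h2
  linear_combination h2 / 2

lemma conv_hasSum {a b : ℝ} (hb : 0 < b) (hab : b < a) (ha : a ≤ 1) (coef : ℤ → ℂ)
    (hs : Summable (fun k => ‖coef k‖)) (x : ℝ) :
    HasSum (fun k : ℤ => (hh a b k : ℂ) * (coef k * Complex.exp (Complex.I * k * x)))
      (∫ y in (-Real.pi)..Real.pi,
          (∑' k : ℤ, coef k * Complex.exp (Complex.I * k * y)) *
            (trapP (-a) (-b) b a (x - y) : ℂ)) := by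
  have hc := trap_cont_s14 hb hab
  have hc' : Continuous fun t => (trap (-a) (-b) b a t : ℂ) :=
    Complex.continuous_ofReal.comp hc
  have hpi := Real.pi_pos
  set G : ℝ → ℂ := fun y => ∑' k : ℤ, coef k * Complex.exp (Complex.I * k * y) with hG
  have hGp : ∀ y, G (y - 2 * Real.pi) = G y := by
    intro y
    simp only [hG]
    refine tsum_congr fun k => ?_
    congr 1
    rw [Complex.exp_eq_exp_iff_exists_int]
    exact ⟨-k, by push_cast; ring⟩
  set g : ℝ → ℂ := fun t => G (x - t) * (trapP (-a) (-b) b a t : ℂ) with hg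
  have hgp : Function.Periodic g (2 * Real.pi) := by
    intro t
    simp only [hg]
    rw [trapP_periodic, ← hGp (x - t)]
    congr 2; ring
  have e1 : ∫ y in (-Real.pi)..Real.pi, G y * (trapP (-a) (-b) b a (x - y) : ℂ) =
      ∫ t in (-Real.pi)..Real.pi, G (x - t) * (trap (-a) (-b) b a t : ℂ) := by
    have h1 := intervalIntegral.integral_comp_sub_left (a := -Real.pi) (b := Real.pi) g x
    have h2 := hgp.intervalIntegral_add_eq (x - Real.pi) (-Real.pi)
    rw [show x - Real.pi + 2 * Real.pi = x - -Real.pi by ring,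
      show -Real.pi + 2 * Real.pi = Real.pi by ring, ← h1] at h2
    simp only [hg, sub_sub_cancel] at h2
    rw [h2]
    apply intervalIntegral.integral_congr
    intro t ht
    rw [Set.uIcc_of_le (by linarith)] at ht
    simp only
    rw [trapP_eq hb hab ha (abs_le.2 ht)]
  have hn : ∀ (k : ℤ) (y : ℝ), ‖Complex.exp (Complex.I * k * y)‖ = 1 := by
    intro k y
    rw [show Complex.I * k * y = ((k * y : ℝ) : ℂ) * Complex.I by push_cast; ring]
    exact Complex.norm_exp_ofReal_mul_I _
  rw [e1]
  have key := intervalIntegral.hasSum_integral_of_dominated_convergence (μ := volume)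
    (a := -Real.pi) (b := Real.pi)
    (F := fun (k : ℤ) (t : ℝ) => (coef k * Complex.exp (Complex.I * k * ((x - t : ℝ) : ℂ))) *
      (trap (-a) (-b) b a t : ℂ))
    (f := fun t => G (x - t) * (trap (-a) (-b) b a t : ℂ))
    (fun k _ => ‖coef k‖)
    (fun k => by
      apply Continuous.aestronglyMeasurable
      fun_prop)
    (fun k => Filter.Eventually.of_forall fun t _ => by
      rw [norm_mul, norm_mul, hn, mul_one, Complex.norm_real, Real.norm_eq_abs,
        abs_of_nonneg (trap_nonneg hb hab t)]
      exact mul_le_of_le_one_right (norm_nonneg _) (trap_le_one hb hab t))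
    (Filter.Eventually.of_forall fun t _ => hs)
    (by simp)
    (Filter.Eventually.of_forall fun t _ => by
      apply HasSum.mul_right
      apply Summable.hasSum
      apply Summable.of_norm
      simpa only [norm_mul, hn, mul_one] using hs)
  refine Eq.mpr (congrArg (fun u => HasSum u _) (funext fun k => ?_)) key
  rw [← exp_int hb hab k, ← intervalIntegral.integral_mul_const]
  congr 1
  ext t
  rw [show Complex.I * k * ((x - t : ℝ) : ℂ) = Complex.I * k * ((-t : ℝ) : ℂ) +
    Complex.I * k * x by push_cast; ring, Complex.exp_add]
  ring

lemma tendsto_Icc_nat : Filter.Tendsto (fun n : ℕ => Finset.Icc (-(n : ℤ)) n)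
    Filter.atTop Filter.atTop := by
  apply Filter.tendsto_atTop_finset_of_monotone
  · intro m n h
    apply Finset.Icc_subset_Icc <;> omega
  · intro k
    exact ⟨k.natAbs, by rw [Finset.mem_Icc]; omega⟩

lemma Icc_step (u : ℤ → ℂ) (n : ℕ) : ∑ k ∈ Finset.Icc (-((n + 1 : ℕ) : ℤ)) ((n + 1 : ℕ) : ℤ), u k =
    (∑ k ∈ Finset.Icc (-(n : ℤ)) n, u k) + (u ((n + 1 : ℕ) : ℤ) + u (-((n + 1 : ℕ) : ℤ))) := by
  have : Finset.Icc (-((n + 1 : ℕ) : ℤ)) ((n + 1 : ℕ) : ℤ) =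
      insert ((n + 1 : ℕ) : ℤ) (insert (-((n + 1 : ℕ) : ℤ)) (Finset.Icc (-(n : ℤ)) n)) := by
    ext k; simp only [Finset.mem_Icc, Finset.mem_insert]; omega
  rw [this, Finset.sum_insert, Finset.sum_insert]
  · ring
  · simp only [Finset.mem_Icc]; omega
  · simp only [Finset.mem_Icc, Finset.mem_insert]; omega

lemma abel_sum (h : ℤ → ℂ) (hev : ∀ k, h (-k) = h k) (u : ℤ → ℂ) (m : ℕ) :
    ∑ k ∈ Finset.Icc (-(m : ℤ)) m, h k * u k =
      (∑ n ∈ Finset.range m, (h n - h ((n + 1 : ℕ) : ℤ)) * ∑ k ∈ Finset.Icc (-(n : ℤ)) n, u k) +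
        h m * ∑ k ∈ Finset.Icc (-(m : ℤ)) m, u k := by
  induction m with
  | zero => simp
  | succ m ih =>
    rw [Icc_step, ih, Finset.sum_range_succ, Icc_step, hev]
    ring

lemma hh_neg (a b k : ℝ) : hh a b (-k) = hh a b k := by
  unfold hh; simp

/-- For `G` with absolutely convergent Fourier series and any finite measure `μ`,
`∫ |(1/(a+b)) G * η|^q dμ ≤ C^q · sup_n ∫ |S_n(G)|^q dμ` for the symmetric
trapezoid `η(−a,−b,b,a)` with `0 < b < a ≤ 1`, `2²⁰(a−b) > b`. -/
theorem stmt_14 : ∃ C > (0 : ℝ), ∀ (q : ℝ), 1 ≤ q →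
    ∀ coef : ℤ → ℂ, Summable (fun k => ‖coef k‖) →
    ∀ μ : Measure ℝ, IsFiniteMeasure μ →
    ∀ a b : ℝ, 0 < b → b < a → a ≤ 1 → b < 2 ^ 20 * (a - b) →
    ∀ K : ℝ,
      (∀ n : ℕ, (∫ x, ‖∑ k ∈ Finset.Icc (-(n : ℤ)) n,
          coef k * Complex.exp (Complex.I * k * x)‖ ^ q ∂μ) ≤ K) →
      (∫ x, ‖(1 / (a + b) : ℂ) * ∫ y in (-Real.pi)..Real.pi,
          (∑' k : ℤ, coef k * Complex.exp (Complex.I * k * y)) *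
            (trapP (-a) (-b) b a (x - y) : ℂ)‖ ^ q ∂μ)
        ≤ C ^ q * K := by
  refine ⟨2 ^ 25, by norm_num, ?_⟩
  intro q hq coef hs μ hμ a b hb hab ha h20 K hK
  have hab0 : 0 < a + b := by linarith
  have hq0 : 0 ≤ q := by linarith
  have hn : ∀ (k : ℤ) (y : ℝ), ‖Complex.exp (Complex.I * k * y)‖ = 1 := by
    intro k y
    rw [show Complex.I * k * y = ((k * y : ℝ) : ℂ) * Complex.I by push_cast; ring]
    exact Complex.norm_exp_ofReal_mul_I _
  set S : ℕ → ℝ → ℂ := fun n x => ∑ k ∈ Finset.Icc (-(n : ℤ)) n,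
          coef k * Complex.exp (Complex.I * k * x) with hS
  have hSc : ∀ n, Continuous (S n) := by intro n; rw [hS]; fun_prop
  have hSb : ∀ n x, ‖S n x‖ ≤ ∑' k, ‖coef k‖ := by
    intro n x
    refine (norm_sum_le _ _).trans ?_
    simp only [norm_mul, hn, mul_one]
    exact hs.sum_le_tsum _ fun i _ => norm_nonneg _
  have hSi : ∀ n, Integrable (fun x => ‖S n x‖ ^ q) μ := by
    intro n
    refine Integrable.of_bound (C := (∑' k, ‖coef k‖) ^ q) ?_ ?_
    · exact ((hSc n).norm.rpow_const fun x => Or.inr hq0).aestronglyMeasurable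
    · refine Filter.Eventually.of_forall fun x => ?_
      rw [Real.norm_of_nonneg (by positivity)]
      exact Real.rpow_le_rpow (norm_nonneg _) (hSb n x) hq0
  have hK0 : 0 ≤ K := le_trans (integral_nonneg fun x => by positivity) (hK 0)
  set F : ℕ → ℝ → ℂ := fun m x => (1 / (a + b) : ℂ) * ∑ k ∈ Finset.Icc (-(m : ℤ)) m,
    (hh a b k : ℂ) * (coef k * Complex.exp (Complex.I * k * x)) with hF
  have hFc : ∀ n, Continuous (F n) := by intro n; rw [hF]; fun_prop
  have hnab : ‖(1 / (a + b) : ℂ)‖ = 1 / (a + b) := by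
    rw [show (1 / (a + b) : ℂ) = ((1 / (a + b) : ℝ) : ℂ) by push_cast; ring, Complex.norm_real,
      Real.norm_of_nonneg (by positivity)]
  have hFb : ∀ n x, ‖F n x‖ ≤ ∑' k, ‖coef k‖ := by
    intro n x
    simp only [hF]
    rw [norm_mul, hnab]
    have : ‖∑ k ∈ Finset.Icc (-(n : ℤ)) n,
        (hh a b k : ℂ) * (coef k * Complex.exp (Complex.I * k * x))‖ ≤
        (a + b) * ∑' k, ‖coef k‖ := by
      refine (norm_sum_le _ _).trans ?_
      simp only [norm_mul, hn, mul_one, Complex.norm_real, Real.norm_eq_abs]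
      calc _ ≤ ∑ k ∈ Finset.Icc (-(n : ℤ)) n, (a + b) * ‖coef k‖ := by
            gcongr with k hk
            exact hh_bound hb hab ha k
        _ = (a + b) * ∑ k ∈ Finset.Icc (-(n : ℤ)) n, ‖coef k‖ := by rw [Finset.mul_sum]
        _ ≤ _ := by
            gcongr
            exact hs.sum_le_tsum _ fun i _ => norm_nonneg _
    rw [one_div, inv_mul_le_iff₀ hab0]
    exact this
  have hFint : ∀ m, ∫ x, ‖F m x‖ ^ q ∂μ ≤ (2 ^ 25 : ℝ) ^ q * K := by
    intro m
    set α : ℕ → ℂ := fun n => if n = m then (1 / (a + b) : ℂ) * (hh a b m : ℂ) else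
      (1 / (a + b) : ℂ) * ((hh a b n : ℂ) - (hh a b ((n + 1 : ℕ) : ℝ) : ℂ)) with hα
    have hne : ∀ n ∈ Finset.range m, n ≠ m := fun n hn => (Finset.mem_range.1 hn).ne
    have hFS : ∀ x, F m x = ∑ n ∈ Finset.range (m + 1), α n * S n x := by
      intro x
      have := abel_sum (fun k => (hh a b k : ℂ)) (by intro k; push_cast; rw [hh_neg])
        (fun k => coef k * Complex.exp (Complex.I * k * x)) m
      simp only [hF]
      rw [this, Finset.sum_range_succ, mul_add, Finset.mul_sum]
      congr 1
      · refine Finset.sum_congr rfl fun n hn => ?_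
        simp only [hα, if_neg (hne n hn), hS]
        push_cast
        ring
      · simp only [hα, hS, if_true]
        push_cast
        ring
    simp only [hFS]
    refine jensen_int _ α S μ q hq K _ (fun i _ => hSi i) (fun i _ => hK i) hK0 ?_
    rw [Finset.sum_range_succ]
    have h1 : ∑ n ∈ Finset.range m, ‖α n‖ =
        1 / (a + b) * ∑ n ∈ Finset.range m, |hh a b n - hh a b ((n + 1 : ℕ) : ℝ)| := by
      rw [Finset.mul_sum]
      refine Finset.sum_congr rfl fun n hn => ?_
      simp only [hα, if_neg (hne n hn)]
      rw [norm_mul, hnab, ← Complex.ofReal_sub, Complex.norm_real, Real.norm_eq_abs]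
    have h2 : ‖α m‖ = 1 / (a + b) * |hh a b m| := by
      simp only [hα, if_true]
      rw [norm_mul, hnab, Complex.norm_real, Real.norm_eq_abs]
    rw [h1, h2, ← mul_add, one_div, inv_mul_le_iff₀ hab0]
    have := sum_diff hb hab ha h20 m
    have := hh_bound hb hab ha m
    linarith
  refine le_of_tendsto' (x := Filter.atTop) ?_ hFint
  apply tendsto_integral_of_dominated_convergence (fun _ => (∑' k, ‖coef k‖) ^ q)
  · intro n
    exact ((hFc n).norm.rpow_const fun x => Or.inr hq0).aestronglyMeasurable
  · exact integrable_const _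
  · intro n
    refine Filter.Eventually.of_forall fun x => ?_
    rw [Real.norm_of_nonneg (by positivity)]
    exact Real.rpow_le_rpow (norm_nonneg _) (hFb n x) hq0
  · refine Filter.Eventually.of_forall fun x => ?_
    have h1 := (conv_hasSum hb hab ha coef hs x)
    have h2 : Filter.Tendsto (fun n => F n x) Filter.atTop (nhds _) :=
      (Filter.Tendsto.comp h1 tendsto_Icc_nat).const_mul (1 / (a + b) : ℂ)
    exact h2.norm.rpow_const (Or.inr hq0)
end
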